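/- arXiv:1405.3379 — 3 statements merged into one kernel-verified Lean document; each statement's English description precedes it below -/
import Mathlib

section
/- Let 0 < r ≤ 1/2 and λ > 0. Let (μ_i)_{i∈ℕ} be a sequence of nonnegative reals and (d_i)_{i∈ℕ} a real sequence with Σ_i d_i² < ∞. Then the two series Σ_i ( λ μ_i^r d_i / (μ_i + λ) )² and Σ_i μ_i^{1+2r} d_i² / (μ_i + λ)² converge, and Σ_i ( λ μ_i^r d_i / (μ_i + λ) )² + λ · Σ_i μ_i^{1+2r} d_i² / (μ_i + λ)² ≤ λ^{2r} · Σ_i d_i². -/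
theorem key_bound (r l m : ℝ) (hr0 : 0 < r) (hr : r ≤ 1 / 2) (hl : 0 < l) (hm : 0 ≤ m) :
    l * m ^ (2 * r) ≤ l ^ (2 * r) * (m + l) := by
  have h := Real.geom_mean_le_arith_mean2_weighted (w₁ := 1 - 2 * r) (w₂ := 2 * r)
    (by linarith) (by linarith) hl.le hm (by ring)
  have h2 : l ^ (1 - 2 * r) * m ^ (2 * r) ≤ m + l := by nlinarith
  have h3 : l ^ (2 * r) * l ^ (1 - 2 * r) = l := by
    rw [← Real.rpow_add hl]; simp
  calc l * m ^ (2 * r) = l ^ (2 * r) * (l ^ (1 - 2 * r) * m ^ (2 * r)) := by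
        rw [← mul_assoc, h3]
    _ ≤ _ := mul_le_mul_of_nonneg_left h2 (Real.rpow_nonneg hl.le _)

theorem term_bound (r l m d : ℝ) (hr0 : 0 < r) (hr : r ≤ 1 / 2) (hl : 0 < l) (hm : 0 ≤ m) :
    (l * m ^ r * d / (m + l)) ^ 2 + l * (m ^ (1 + 2 * r) * d ^ 2 / (m + l) ^ 2)
      ≤ l ^ (2 * r) * d ^ 2 := by
  have hp : 0 < m + l := by linarith
  have e1 : m ^ (1 + 2 * r) = m * m ^ (2 * r) := by
    rw [Real.rpow_add_of_nonneg hm (by norm_num) (by linarith), Real.rpow_one]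
  have e2 : (m ^ r) ^ 2 = m ^ (2 * r) := by
    rw [mul_comm, Real.rpow_mul hm]; norm_num
  have e : (l * m ^ r * d / (m + l)) ^ 2 + l * (m ^ (1 + 2 * r) * d ^ 2 / (m + l) ^ 2)
      = l * m ^ (2 * r) / (m + l) * d ^ 2 := by
    rw [div_pow, mul_pow, mul_pow, e1, e2]
    field_simp
    ring
  rw [e]
  refine mul_le_mul_of_nonneg_right ?_ (sq_nonneg d)
  rw [div_le_iff₀ hp]
  exact key_bound r l m hr0 hr hl hm

/-- Spectral form of the intermediate-function lemma: the eigenvalue-sequence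
inequality `‖f_λ − f*‖² + λ‖f_λ‖² ≤ λ^{2r} ‖g*‖²`. -/
theorem spectral_intermediate_function (r lam : ℝ) (hr0 : 0 < r) (hr : r ≤ 1 / 2)
    (hlam : 0 < lam) (μ d : ℕ → ℝ) (hμ : ∀ i, 0 ≤ μ i)
    (hd : Summable fun i => (d i) ^ 2) :
    Summable (fun i => (lam * (μ i) ^ r * d i / (μ i + lam)) ^ 2) ∧
    Summable (fun i => (μ i) ^ (1 + 2 * r) * (d i) ^ 2 / (μ i + lam) ^ 2) ∧
    (∑' i, (lam * (μ i) ^ r * d i / (μ i + lam)) ^ 2) +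
        lam * ∑' i, (μ i) ^ (1 + 2 * r) * (d i) ^ 2 / (μ i + lam) ^ 2 ≤
      lam ^ (2 * r) * ∑' i, (d i) ^ 2 := by
  have hb := fun i => term_bound r lam (μ i) (d i) hr0 hr hlam (hμ i)
  have n1 : ∀ i, 0 ≤ (lam * (μ i) ^ r * d i / (μ i + lam)) ^ 2 := fun i => sq_nonneg _
  have n2 : ∀ i, 0 ≤ (μ i) ^ (1 + 2 * r) * (d i) ^ 2 / (μ i + lam) ^ 2 := fun i => by
    have := Real.rpow_nonneg (hμ i) (1 + 2 * r)
    positivity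
  have n3 := fun i => mul_nonneg hlam.le (n2 i)
  have hs := hd.mul_left (lam ^ (2 * r))
  have s1 := Summable.of_nonneg_of_le n1 (fun i => by linarith [hb i, n3 i]) hs
  have s2 := Summable.of_nonneg_of_le n3 (fun i => by linarith [hb i, n1 i]) hs
  refine ⟨s1, (summable_mul_left_iff hlam.ne').1 s2, ?_⟩
  rw [← tsum_mul_left, ← tsum_mul_left, ← s1.tsum_add s2]
  exact (s1.add s2).tsum_le_tsum hb hs
end

section
/- Let s ≥ 1 be a natural number, ζ ∈ (0,2), c > 0, and R ≥ 1. Let X_1, …, X_s be sets and for each j let B_j be a set of functions X_j → ℝ. Assume that for every j, every ε > 0, every n ≥ 1, and every sample x ∈ X_j^n, there exists a finite set T of functions X_j → ℝ with (card T : ℝ) ≤ exp(c · ε^{−ζ}) such that every f ∈ B_j is within empirical distance d_{2,x}(f,t) ≤ ε of some t ∈ T. Then for every ε > 0, every n ≥ 1, and every sample x ∈ (X_1 × … × X_s)^n, there exists a finite set T of functions X_1 × … × X_s → ℝ with (card T : ℝ) ≤ exp( s^{1+ζ} · c · (R/ε)^ζ ) such that every function in the scaled sum class { (x_1,…,x_s)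 ↦ R·f_1(x_1) + … + R·f_s(x_s) : f_j ∈ B_j } is within empirical distance ε of some element of T. -/
/-- Empirical ℓ₂ pseudo-distance between two real-valued functions with respect to a
sample `x = (x_1, …, x_n)`. -/
noncomputable def empDist {X : Type*} {n : ℕ} (x : Fin n → X) (f g : X → ℝ) : ℝ :=
  Real.sqrt ((1 / (n : ℝ)) * ∑ i, (f (x i) - g (x i)) ^ 2)

/-- Covering number theorem for additive models: if each unit ball `B_j` has log
ℓ₂-empirical covering numbers bounded by `c ε^{−ζ}`, then the scaled sum class
`{R f_1 + … + R f_s}` has log covering numbers bounded by `s^{1+ζ} c (R/ε)^ζ`. -/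
theorem covering_number_additive (s : ℕ) (hs : 1 ≤ s) (ζ c R : ℝ)
    (hζ : ζ ∈ Set.Ioo (0 : ℝ) 2) (hc : 0 < c) (hR : 1 ≤ R)
    (X : Fin s → Type*) (B : (j : Fin s) → Set (X j → ℝ))
    (hB : ∀ (j : Fin s) (ε : ℝ), 0 < ε → ∀ (n : ℕ), 1 ≤ n → ∀ x : Fin n → X j,
      ∃ T : Finset (X j → ℝ), (T.card : ℝ) ≤ Real.exp (c * ε ^ (-ζ)) ∧
        ∀ f ∈ B j, ∃ t ∈ T, empDist x f t ≤ ε) :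
    ∀ (ε : ℝ), 0 < ε → ∀ (n : ℕ), 1 ≤ n → ∀ x : Fin n → ((j : Fin s) → X j),
      ∃ T : Finset (((j : Fin s) → X j) → ℝ),
        (T.card : ℝ) ≤ Real.exp ((s : ℝ) ^ (1 + ζ) * c * (R / ε) ^ ζ) ∧
        ∀ f : (j : Fin s) → (X j → ℝ), (∀ j, f j ∈ B j) →
          ∃ t ∈ T, empDist x (fun y => ∑ j, R * f j (y j)) t ≤ ε := by
  intro ε hε n hn x
  classical
  have hs0 : (0 : ℝ) < s := by exact_mod_cast hs
  have hR0 : (0 : ℝ) < R := by linarith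
  have hδ : 0 < ε / (s * R) := by positivity
  choose T hT hcov using fun j => hB j (ε / (s * R)) hδ n hn (fun i => x i j)
  refine ⟨(Fintype.piFinset T).image (fun t y => ∑ j, R * t j (y j)), ?_, ?_⟩
  · have h1 : (((Fintype.piFinset T).image
        (fun t (y : (j : Fin s) → X j) => ∑ j, R * t j (y j))).card : ℝ)
        ≤ ∏ j, ((T j).card : ℝ) := by
      have := Finset.card_image_le (s := Fintype.piFinset T)
        (f := fun t (y : (j : Fin s) → X j) => ∑ j, R * t j (y j))
      rw [Fintype.card_piFinset] at this
      exact_mod_cast this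
    refine h1.trans ((Finset.prod_le_prod (fun _ _ => by positivity)
      (fun j _ => hT j)).trans (le_of_eq ?_))
    rw [← Real.exp_sum]
    congr 1
    have e : (ε / (s * R)) ^ (-ζ) = (s : ℝ) ^ ζ * (R / ε) ^ ζ := by
      rw [Real.rpow_neg hδ.le, ← Real.inv_rpow hδ.le,
        ← Real.mul_rpow hs0.le (by positivity)]
      congr 1
      field_simp
    rw [Finset.sum_const, Finset.card_univ, Fintype.card_fin, nsmul_eq_mul, e,
      Real.rpow_add hs0, Real.rpow_one]
    ring
  · intro f hf
    choose t ht hd using fun j => hcov j (f j) (hf j)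
    refine ⟨_, Finset.mem_image_of_mem _ (Fintype.mem_piFinset.2 ht), ?_⟩
    have hd2 : ∀ j, (1 / (n : ℝ)) * ∑ i, (f j (x i j) - t j (x i j)) ^ 2
        ≤ (ε / (s * R)) ^ 2 := fun j => (Real.sqrt_le_left hδ.le).1 (hd j)
    unfold empDist
    rw [Real.sqrt_le_left hε.le]
    have hi : ∀ i, (∑ j, R * f j (x i j) - ∑ j, R * t j (x i j)) ^ 2
        ≤ s * R ^ 2 * ∑ j, (f j (x i j) - t j (x i j)) ^ 2 := by
      intro i
      have := sq_sum_le_card_mul_sum_sq (s := (Finset.univ : Finset (Fin s)))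
        (f := fun j => f j (x i j) - t j (x i j))
      rw [Finset.card_univ, Fintype.card_fin] at this
      rw [← Finset.mul_sum, ← Finset.mul_sum, ← mul_sub, ← Finset.sum_sub_distrib, mul_pow]
      nlinarith [mul_le_mul_of_nonneg_left this (sq_nonneg R)]
    calc (1 / (n : ℝ)) * ∑ i, (∑ j, R * f j (x i j) - ∑ j, R * t j (x i j)) ^ 2
        ≤ (1 / (n : ℝ)) * ∑ i, s * R ^ 2 * ∑ j, (f j (x i j) - t j (x i j)) ^ 2 := by
          gcongr with i _
          exact hi i
      _ = s * R ^ 2 * ∑ j, (1 / (n : ℝ)) * ∑ i, (f j (x i j) - t j (x i j)) ^ 2 := by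
          rw [← Finset.mul_sum, ← Finset.mul_sum, Finset.sum_comm]
          ring
      _ ≤ s * R ^ 2 * ∑ j : Fin s, (ε / (s * R)) ^ 2 := by
          gcongr with j _
          exact hd2 j
      _ = ε ^ 2 := by
          rw [Finset.sum_const, Finset.card_univ, Fintype.card_fin, nsmul_eq_mul]
          field_simp
end

section
/- Let α ≥ 1 and β ≥ 1 be reals, and let (R_ℓ)_{ℓ∈ℕ} be a sequence of reals with R_ℓ ≥ 1 for all ℓ and R_{ℓ+1} ≤ max{ α·√(R_ℓ), β } for all ℓ. Then for every J ∈ ℕ, R_J ≤ α² · β · R_0^{2^{−J}}. -/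
/-- Recursion bound for the iteration technique: if `R_{ℓ+1} ≤ max{α √(R_ℓ), β}`
with `R_ℓ ≥ 1`, `α, β ≥ 1`, then `R_J ≤ α² β R_0^{2^{−J}}`. -/
theorem iteration_recursion_bound (α β : ℝ) (hα : 1 ≤ α) (hβ : 1 ≤ β)
    (R : ℕ → ℝ) (hR1 : ∀ ℓ, 1 ≤ R ℓ)
    (hrec : ∀ ℓ, R (ℓ + 1) ≤ max (α * Real.sqrt (R ℓ)) β) :
    ∀ J : ℕ, R J ≤ α ^ 2 * β * (R 0) ^ ((2 : ℝ) ^ (-(J : ℝ))) := by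
  intro J
  induction J with
  | zero =>
    have h0 := hR1 0
    have h2 : 1 ≤ α ^ 2 * β := by nlinarith
    simp
    nlinarith
  | succ J ih =>
    have h0 : 0 < R 0 := by linarith [hR1 0]
    have hY1 : 1 ≤ (R 0) ^ ((2 : ℝ) ^ (-((J + 1 : ℕ) : ℝ))) :=
      Real.one_le_rpow (hR1 0) (by positivity)
    have hYY : (R 0) ^ ((2 : ℝ) ^ (-(J : ℝ))) =
        (R 0) ^ ((2 : ℝ) ^ (-((J + 1 : ℕ) : ℝ))) * (R 0) ^ ((2 : ℝ) ^ (-((J + 1 : ℕ) : ℝ))) := by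
      rw [← Real.rpow_add h0]
      congr 1
      have : -(J : ℝ) = -((J + 1 : ℕ) : ℝ) + 1 := by push_cast; ring
      rw [this, Real.rpow_add (by norm_num), Real.rpow_one]
      ring
    rw [hYY] at ih
    generalize (R 0) ^ ((2 : ℝ) ^ (-((J + 1 : ℕ) : ℝ))) = Y at *
    have hα2 : 1 ≤ α ^ 2 := by nlinarith
    refine (hrec J).trans (max_le ?_ ?_)
    · have hs : Real.sqrt (R J) ≤ α * β * Y := by
        apply Real.sqrt_le_iff.mpr
        refine ⟨by positivity, ih.trans ?_⟩
        have h3 : 0 ≤ α ^ 2 * β * (Y * Y) := by positivity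
        nlinarith [mul_nonneg h3 (sub_nonneg.2 hβ)]
      calc α * Real.sqrt (R J) ≤ α * (α * β * Y) := by gcongr
        _ = α ^ 2 * β * Y := by ring
    · have h4 : 1 ≤ α ^ 2 * Y := by nlinarith
      nlinarith
end
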